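/- arXiv:1804.11269 — 2 statements merged into one kernel-verified Lean document; each statement's English description precedes it below -/
import Mathlib

section
/- For n ≥ 2k², if A and B are disjoint cross-intersecting families of k-subsets of [n], then min{|A|, |B|} ≤ (1/2)·C(n-1, k-1). -/
open Finset

/-- The number of `k`-subsets of an `n`-set that contain a given `j`-set. -/
def supersetCount (n k j : ℕ) : ℕ := if j ≤ k then (n - j).choose (k - j) else 0

lemma mul_supersetCount_succ {n k : ℕ} (hkn : k ≤ n) (j : ℕ) :
    (n - j) * supersetCount n k (j + 1) = (k - j) * supersetCount n k j := by
  unfold supersetCount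
  rcases lt_or_ge j k with h | h
  · obtain ⟨a, rfl⟩ : ∃ a, k = j + 1 + a := ⟨k - (j + 1), by omega⟩
    obtain ⟨b, rfl⟩ : ∃ b, n = j + 1 + b := ⟨n - (j + 1), by omega⟩
    have e1 : j + 1 + b - j = b + 1 := by omega
    have e2 : j + 1 + a - j = a + 1 := by omega
    rw [if_pos (by omega), if_pos (by omega), e1, e2, Nat.add_sub_cancel_left,
      Nat.add_sub_cancel_left, Nat.add_one_mul_choose_eq, mul_comm]
  · rw [if_neg (by omega), Nat.sub_eq_zero_of_le h]
    simp

lemma two_mul_supersetCount_succ_le {n k : ℕ} (hk : 0 < k) (hn : 2 * k ^ 2 ≤ n) (j : ℕ) :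
    2 * k * supersetCount n k (j + 1) ≤ supersetCount n k j := by
  have hkn : k < n := by nlinarith
  rcases lt_or_ge j k with h | h
  · refine le_of_mul_le_mul_left (a := n - j) ?_ (by omega)
    calc (n - j) * (2 * k * supersetCount n k (j + 1))
        = 2 * k * ((n - j) * supersetCount n k (j + 1)) := by ring
      _ = 2 * k * (k - j) * supersetCount n k j := by
          rw [mul_supersetCount_succ (by omega)]; ring
      _ ≤ (n - j) * supersetCount n k j := by
          refine Nat.mul_le_mul_right _ ?_
          obtain ⟨a, rfl⟩ := Nat.exists_eq_add_of_lt h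
          have e : j + a + 1 - j = a + 1 := by omega
          rw [e]
          apply Nat.le_sub_of_add_le
          nlinarith
  · simp [supersetCount, show ¬ j + 1 ≤ k by omega]

lemma two_mul_pow_mul_supersetCount_le {n k : ℕ} (hk : 0 < k) (hn : 2 * k ^ 2 ≤ n) (i m : ℕ) :
    (2 * k) ^ m * supersetCount n k (i + m) ≤ supersetCount n k i := by
  induction m with
  | zero => simp
  | succ m ih =>
    calc (2 * k) ^ (m + 1) * supersetCount n k (i + (m + 1))
        = (2 * k) ^ m * (2 * k * supersetCount n k (i + m + 1)) := by rw [pow_succ]; ring_nf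
      _ ≤ (2 * k) ^ m * supersetCount n k (i + m) :=
          Nat.mul_le_mul_left _ (two_mul_supersetCount_succ_le hk hn _)
      _ ≤ _ := ih

lemma two_mul_succ_mul_supersetCount_two_le {n k : ℕ} (hk : 0 < k) (hn : 2 * k ^ 2 ≤ n) :
    2 * ((k + 1) * supersetCount n k 2) ≤ supersetCount n k 1 := by
  have hkn : k < n := by nlinarith
  refine le_of_mul_le_mul_left (a := n - 1) ?_ (by omega)
  calc (n - 1) * (2 * ((k + 1) * supersetCount n k 2))
      = 2 * (k + 1) * ((n - 1) * supersetCount n k (1 + 1)) := by ring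
    _ = 2 * (k + 1) * (k - 1) * supersetCount n k 1 := by
        rw [mul_supersetCount_succ (by omega)]; ring
    _ ≤ (n - 1) * supersetCount n k 1 := by
        refine Nat.mul_le_mul_right _ ?_
        obtain ⟨a, rfl⟩ := Nat.exists_eq_add_of_lt hk
        have e : 0 + a + 1 - 1 = a := by omega
        rw [e]
        apply Nat.le_sub_of_add_le
        nlinarith

section Families

variable {α : Type*} [DecidableEq α] {A B : Finset (Finset α)} {k : ℕ}

lemma card_filter_superset_le [Fintype α] (hA : A ⊆ powersetCard k univ) (Z : Finset α) :
    #{a ∈ A | Z ⊆ a} ≤ supersetCount (Fintype.card α) k #Z := by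
  unfold supersetCount
  split_ifs with h
  · rw [← card_compl, ← card_powersetCard]
    refine card_le_card_of_injOn (· \ Z) ?_ ?_
    · intro a ha
      simp only [coe_filter, Set.mem_ofPred_eq] at ha
      simp only [mem_coe, mem_powersetCard]
      refine ⟨fun x hx => by simp_all, ?_⟩
      rw [card_sdiff_of_subset ha.2, (mem_powersetCard.1 (hA ha.1)).2]
    · intro a ha b hb hab
      simp only [coe_filter, Set.mem_ofPred_eq] at ha hb
      rw [← sdiff_union_of_subset ha.2, ← sdiff_union_of_subset hb.2]
      exact congrArg (· ∪ Z) hab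
  · rw [Nat.le_zero, card_eq_zero, filter_eq_empty_iff]
    intro a ha hZ
    have := card_le_card hZ
    rw [(mem_powersetCard.1 (hA ha)).2] at this
    exact h this

/-- If all members of `A` meet `b`, then those containing `Z` split according to a point of `b`. -/
lemma card_filter_superset_le_sum {b : Finset α} (hb : ∀ a ∈ A, ¬ Disjoint b a) (Z : Finset α) :
    #{a ∈ A | Z ⊆ a} ≤ ∑ y ∈ b, #{a ∈ A | insert y Z ⊆ a} := by
  refine le_trans (card_le_card ?_) card_biUnion_le
  intro a ha
  rw [mem_filter] at ha
  obtain ⟨y, hyb, hya⟩ := not_disjoint_iff.1 (hb a ha.1)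
  exact mem_biUnion.2 ⟨y, hyb, mem_filter.2 ⟨ha.1, insert_subset hya ha.2⟩⟩

lemma card_filter_superset_le_pow_mul (hB : ∀ b ∈ B, #b = k)
    (hcross : ∀ a ∈ A, ∀ b ∈ B, ¬ Disjoint b a) {t M : ℕ}
    (hcov : ∀ Z : Finset α, #Z < t → ∃ b ∈ B, Disjoint Z b)
    (hM : ∀ Z : Finset α, #Z = t → #{a ∈ A | Z ⊆ a} ≤ M) (d : ℕ) (Z : Finset α)
    (hZ : #Z + d = t) : #{a ∈ A | Z ⊆ a} ≤ k ^ d * M := by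
  induction d generalizing Z with
  | zero => simpa using hM Z hZ
  | succ d ih =>
    obtain ⟨b, hb, hZb⟩ := hcov Z (by omega)
    calc #{a ∈ A | Z ⊆ a} ≤ ∑ y ∈ b, #{a ∈ A | insert y Z ⊆ a} :=
          card_filter_superset_le_sum (fun a ha => hcross a ha b hb) Z
      _ ≤ #b • (k ^ d * M) := by
          refine sum_le_card_nsmul _ _ _ fun y hy => ih _ ?_
          rw [card_insert_of_notMem (disjoint_right.1 hZb hy)]
          omega
      _ = k ^ (d + 1) * M := by rw [hB b hb, smul_eq_mul, pow_succ]; ring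

/-- The members of `A` containing `Z` are few unless the members of `B` missing `Z` share a
pair. -/
lemma card_filter_superset_le_of_no_common_pair [Fintype α] (hk : 0 < k)
    (hA : A ⊆ powersetCard k univ) (hB : ∀ b ∈ B, #b = k)
    (hcross : ∀ a ∈ A, ∀ b ∈ B, ¬ Disjoint b a) {Z : Finset α}
    (hcov : ∃ b ∈ B, Disjoint Z b)
    (hpair : ∀ P : Finset α, #P = 2 → ∃ b ∈ B, Disjoint Z b ∧ ¬ P ⊆ b) :
    #{a ∈ A | Z ⊆ a} ≤ supersetCount (Fintype.card α) k (#Z + 1) +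
      (k - 1) * (k * supersetCount (Fintype.card α) k (#Z + 2)) := by
  obtain ⟨b, hb, hZb⟩ := hcov
  obtain ⟨z₀, hz₀, h⟩ : ∃ z₀ ∈ b, ∀ z ∈ b, z ≠ z₀ → ∃ b' ∈ B, Disjoint (insert z Z) b' := by
    by_cases hcore : ∃ z₀ ∈ b, ∀ b' ∈ B, Disjoint Z b' → z₀ ∈ b'
    · obtain ⟨z₀, hz₀, hc⟩ := hcore
      refine ⟨z₀, hz₀, fun z _ hne => ?_⟩
      obtain ⟨b', hb', hZ', hP⟩ := hpair {z, z₀} (card_pair hne)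
      refine ⟨b', hb', disjoint_insert_left.2 ⟨fun hz => hP ?_, hZ'⟩⟩
      exact insert_subset hz (singleton_subset_iff.2 (hc b' hb' hZ'))
    · push Not at hcore
      obtain ⟨z₀, hz₀⟩ : b.Nonempty := card_pos.1 (by rw [hB b hb]; exact hk)
      refine ⟨z₀, hz₀, fun z hz _ => ?_⟩
      obtain ⟨b', hb', hZ', hz'⟩ := hcore z hz
      exact ⟨b', hb', disjoint_insert_left.2 ⟨hz', hZ'⟩⟩
  have hcard : ∀ y ∈ b, #(insert y Z) = #Z + 1 := fun y hy =>
    card_insert_of_notMem (disjoint_right.1 hZb hy)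
  refine (card_filter_superset_le_sum (fun a ha => hcross a ha b hb) Z).trans ?_
  rw [← add_sum_erase _ _ hz₀]
  refine add_le_add ?_ ?_
  · rw [← hcard z₀ hz₀]
    exact card_filter_superset_le hA _
  · rw [← hB b hb, ← card_erase_of_mem hz₀, ← smul_eq_mul]
    refine sum_le_card_nsmul _ _ _ fun z hz => ?_
    obtain ⟨b', hb', hd⟩ := h z (mem_of_mem_erase hz) (ne_of_mem_erase hz)
    refine (card_filter_superset_le_sum (fun a ha => hcross a ha b' hb') _).trans ?_
    rw [hB b hb, ← hB b' hb', ← smul_eq_mul]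
    refine sum_le_card_nsmul _ _ _ fun y hy => ?_
    have hc : #(insert y (insert z Z)) = #Z + 2 := by
      rw [card_insert_of_notMem (disjoint_right.1 hd hy), hcard z (mem_of_mem_erase hz)]
    rw [← hc, hB b' hb']
    exact card_filter_superset_le hA _

lemma card_le_of_common_pair [Fintype α] (hB : B ⊆ powersetCard k univ) {Z P : Finset α}
    (hP : #P = 2) (hZP : ∀ b ∈ B, Disjoint Z b → P ⊆ b) :
    #B ≤ supersetCount (Fintype.card α) k 2 + ∑ z ∈ Z, #{b ∈ B | {z} ⊆ b} := by
  have hsub : B ⊆ {b ∈ B | P ⊆ b} ∪ Z.biUnion fun z => {b ∈ B | {z} ⊆ b} := by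
    intro b hb
    by_cases hd : Disjoint Z b
    · exact mem_union_left _ (mem_filter.2 ⟨hb, hZP b hb hd⟩)
    · obtain ⟨z, hzZ, hzb⟩ := not_disjoint_iff.1 hd
      exact mem_union_right _
        (mem_biUnion.2 ⟨z, hzZ, mem_filter.2 ⟨hb, singleton_subset_iff.2 hzb⟩⟩)
  refine (card_le_card hsub).trans ((card_union_le _ _).trans (add_le_add ?_ card_biUnion_le))
  rw [← hP]
  exact card_filter_superset_le hB P

/-- If `S` is a smallest set covering `A` or `B`, covers `A`, and has at least two points, then one
of the families has at most half the size of a full star. -/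
lemma two_mul_card_le_of_min_cover [Fintype α] (hk : 0 < k) (hn : 2 * k ^ 2 ≤ Fintype.card α)
    (hA : A ⊆ powersetCard k univ) (hB : B ⊆ powersetCard k univ)
    (hcross : ∀ a ∈ A, ∀ b ∈ B, ¬ Disjoint b a) {m : ℕ} {S : Finset α} (hS : #S = m + 2)
    (hSA : ∀ a ∈ A, ¬ Disjoint S a)
    (hcovA : ∀ Z : Finset α, #Z < m + 2 → ∃ a ∈ A, Disjoint Z a)
    (hcovB : ∀ Z : Finset α, #Z < m + 2 → ∃ b ∈ B, Disjoint Z b) :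
    2 * #A ≤ supersetCount (Fintype.card α) k 1 ∨
      2 * #B ≤ supersetCount (Fintype.card α) k 1 := by
  have hA' : ∀ a ∈ A, #a = k := fun a ha => (mem_powersetCard.1 (hA ha)).2
  have hB' : ∀ b ∈ B, #b = k := fun b hb => (mem_powersetCard.1 (hB hb)).2
  set g := supersetCount (Fintype.card α) k
  have hchain : (2 * k) ^ m * g (m + 2) ≤ g 2 := by
    rw [add_comm m]; exact two_mul_pow_mul_supersetCount_le hk hn 2 m
  have hm : m + 1 ≤ 2 ^ m := Nat.lt_two_pow_self
  have hstar : 2 * ((k + 1) * g 2) ≤ g 1 := two_mul_succ_mul_supersetCount_two_le hk hn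
  by_cases hpair : ∃ Z P : Finset α, #Z = m + 1 ∧ #P = 2 ∧ ∀ b ∈ B, Disjoint Z b → P ⊆ b
  · right
    obtain ⟨Z, P, hZ, hP, hZP⟩ := hpair
    have hdeg : ∀ z ∈ Z, #{b ∈ B | {z} ⊆ b} ≤ k ^ (m + 1) * g (m + 2) := fun z _ =>
      card_filter_superset_le_pow_mul hA' (fun b hb a ha h => hcross a ha b hb h.symm) hcovA
        (fun Y hY => hY ▸ card_filter_superset_le hB Y) (m + 1) {z}
        (by rw [card_singleton]; omega)
    refine le_trans (Nat.mul_le_mul_left 2 ?_) hstar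
    calc #B ≤ g 2 + ∑ z ∈ Z, #{b ∈ B | {z} ⊆ b} := card_le_of_common_pair hB hP hZP
      _ ≤ g 2 + (m + 1) * (k ^ (m + 1) * g (m + 2)) := by
          have := sum_le_card_nsmul _ _ _ hdeg
          rw [hZ, smul_eq_mul] at this
          omega
      _ ≤ g 2 + 2 ^ m * (k ^ (m + 1) * g (m + 2)) := by gcongr
      _ = g 2 + k * ((2 * k) ^ m * g (m + 2)) := by rw [mul_pow]; ring
      _ ≤ g 2 + k * g 2 := by gcongr
      _ = (k + 1) * g 2 := by ring
  · left
    push Not at hpair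
    set M := g (m + 2) + (k - 1) * (k * g (m + 3)) with hM
    have hMle : 2 * M ≤ (k + 1) * g (m + 2) := by
      have h := two_mul_supersetCount_succ_le hk hn (m + 2)
      obtain ⟨c, rfl⟩ : ∃ c, k = c + 1 := ⟨k - 1, by omega⟩
      have h' := Nat.mul_le_mul_left c h
      rw [hM, Nat.add_sub_cancel]
      change c * (2 * (c + 1) * g (m + 3)) ≤ c * g (m + 2) at h'
      linarith
    have hdeg : ∀ u ∈ S, #{a ∈ A | insert u ∅ ⊆ a} ≤ k ^ m * M := fun u _ =>
      card_filter_superset_le_pow_mul (t := m + 1) hB' hcross (fun Z hZ => hcovB Z (by omega))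
        (fun Z hZ => by
          have := card_filter_superset_le_of_no_common_pair hk hA hB' hcross
            (hcovB Z (by omega)) (fun P hP => hpair Z P hZ hP)
          rwa [hZ] at this) m _ (by rw [insert_empty_eq, card_singleton]; omega)
    refine le_trans (Nat.mul_le_mul_left 2 ?_) hstar
    refine le_of_mul_le_mul_left (a := 2) ?_ two_pos
    calc 2 * #A = 2 * #{a ∈ A | ∅ ⊆ a} := by simp
      _ ≤ 2 * ((m + 2) * (k ^ m * M)) := by
          have := (card_filter_superset_le_sum hSA ∅).trans (sum_le_card_nsmul _ _ _ hdeg)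
          rw [hS, smul_eq_mul] at this
          omega
      _ = (m + 2) * k ^ m * (2 * M) := by ring
      _ ≤ (2 * 2 ^ m) * k ^ m * ((k + 1) * g (m + 2)) := by gcongr; omega
      _ = 2 * ((k + 1) * ((2 * k) ^ m * g (m + 2))) := by rw [mul_pow]; ring
      _ ≤ 2 * ((k + 1) * g 2) := by gcongr

/-- If `A` is contained in a star, then one of the two families has at most half the size of a full
star. -/
lemma two_mul_card_le_of_star [Fintype α] (hk : 0 < k) (hn : 2 * k ^ 2 ≤ Fintype.card α)
    (hA : A ⊆ powersetCard k univ) (hB : B ⊆ powersetCard k univ) (hdisj : Disjoint A B)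
    (hcross : ∀ a ∈ A, ∀ b ∈ B, ¬ Disjoint b a) {x : α} (hx : ∀ a ∈ A, x ∈ a) :
    2 * #A ≤ supersetCount (Fintype.card α) k 1 ∨
      2 * #B ≤ supersetCount (Fintype.card α) k 1 := by
  by_cases hxB : ∀ b ∈ B, x ∈ b
  · have hAB : A ∪ B ⊆ powersetCard k univ := union_subset hA hB
    have h := card_filter_superset_le hAB {x}
    rw [filter_true_of_mem, card_union_of_disjoint hdisj, card_singleton] at h
    · omega
    · intro c hc
      rw [singleton_subset_iff]
      exact (mem_union.1 hc).elim (hx c) (hxB c)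
  · push Not at hxB
    obtain ⟨b, hb, hxb⟩ := hxB
    left
    refine le_trans ?_ (two_mul_supersetCount_succ_le hk hn 1)
    rw [mul_assoc]
    refine Nat.mul_le_mul_left 2 ?_
    have h := card_filter_superset_le_sum (fun a ha => hcross a ha b hb) {x}
    rw [filter_true_of_mem fun a ha => singleton_subset_iff.2 (hx a ha)] at h
    refine h.trans ?_
    rw [← (mem_powersetCard.1 (hB hb)).2, ← smul_eq_mul]
    refine sum_le_card_nsmul _ _ _ fun y hy => ?_
    have hyx : y ≠ x := fun e => hxb (e ▸ hy)
    rw [(mem_powersetCard.1 (hB hb)).2]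
    exact (card_filter_superset_le hA {y, x}).trans_eq (by rw [card_pair hyx])

lemma two_mul_card_le_or_two_mul_card_le [Fintype α] (hn : 2 * k ^ 2 ≤ Fintype.card α)
    (hA : A ⊆ powersetCard k univ) (hB : B ⊆ powersetCard k univ) (hdisj : Disjoint A B)
    (hcross : ∀ a ∈ A, ∀ b ∈ B, ¬ Disjoint b a) :
    2 * #A ≤ supersetCount (Fintype.card α) k 1 ∨
      2 * #B ≤ supersetCount (Fintype.card α) k 1 := by
  classical
  rcases A.eq_empty_or_nonempty with rfl | ⟨a₀, ha₀⟩
  · simp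
  rcases B.eq_empty_or_nonempty with rfl | ⟨b₀, hb₀⟩
  · simp
  have hcross' : ∀ b ∈ B, ∀ a ∈ A, ¬ Disjoint a b :=
    fun b hb a ha h => hcross a ha b hb h.symm
  have ha₀k := (mem_powersetCard.1 (hA ha₀)).2
  have hk : 0 < k := by
    rw [← ha₀k, card_pos]
    exact nonempty_of_ne_empty fun h => hcross a₀ ha₀ b₀ hb₀ (by simp [h])
  have hex : ∃ s, ∃ S : Finset α, #S = s ∧
      ((∀ a ∈ A, ¬ Disjoint S a) ∨ ∀ b ∈ B, ¬ Disjoint S b) :=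
    ⟨k, a₀, ha₀k, Or.inr fun b hb => hcross' b hb a₀ ha₀⟩
  obtain ⟨S, hS, hcov⟩ := Nat.find_spec hex
  have hmin : ∀ Z : Finset α, #Z < Nat.find hex →
      (∃ a ∈ A, Disjoint Z a) ∧ ∃ b ∈ B, Disjoint Z b := by
    intro Z hZ
    have := Nat.find_min hex hZ
    push Not at this
    exact this Z rfl
  generalize Nat.find hex = s at hS hmin
  match s, hS, hmin with
  | 0, hS, _ =>
    rw [card_eq_zero] at hS
    subst hS
    rcases hcov with h | h
    · exact absurd (disjoint_empty_left _) (h a₀ ha₀)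
    · exact absurd (disjoint_empty_left _) (h b₀ hb₀)
  | 1, hS, _ =>
    obtain ⟨x, rfl⟩ := card_eq_one.1 hS
    simp only [disjoint_singleton_left, not_not] at hcov
    rcases hcov with h | h
    · exact two_mul_card_le_of_star hk hn hA hB hdisj hcross h
    · exact (two_mul_card_le_of_star hk hn hB hA hdisj.symm hcross' h).symm
  | m + 2, hS, hmin =>
    rcases hcov with h | h
    · exact two_mul_card_le_of_min_cover hk hn hA hB hcross hS h
        (fun Z hZ => (hmin Z hZ).1) (fun Z hZ => (hmin Z hZ).2)
    · exact (two_mul_card_le_of_min_cover hk hn hB hA hcross' hS h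
        (fun Z hZ => (hmin Z hZ).2) (fun Z hZ => (hmin Z hZ).1)).symm

end Families

theorem stmt_1 (n k : ℕ) (hn : n ≥ 2 * k ^ 2)
    (A B : Finset (Finset (Fin n)))
    (hA : A ⊆ Finset.powersetCard k Finset.univ)
    (hB : B ⊆ Finset.powersetCard k Finset.univ)
    (hdisj : Disjoint A B)
    (hcross : ∀ a ∈ A, ∀ b ∈ B, (a ∩ b).Nonempty) :
    (min A.card B.card : ℚ) ≤ (1 / 2) * (n - 1).choose (k - 1) := by
  have h := two_mul_card_le_or_two_mul_card_le (by simpa using hn) hA hB hdisj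
    (fun a ha b hb h => not_disjoint_iff_nonempty_inter.2 (hcross a ha b hb) h.symm)
  have hle : supersetCount (Fintype.card (Fin n)) k 1 ≤ (n - 1).choose (k - 1) := by
    rw [Fintype.card_fin, supersetCount]
    split_ifs <;> simp
  rcases h with h | h
  · have h' : (2 * #A : ℚ) ≤ (n - 1).choose (k - 1) := by exact_mod_cast h.trans hle
    exact (min_le_left _ _).trans (by linarith)
  · have h' : (2 * #B : ℚ) ≤ (n - 1).choose (k - 1) := by exact_mod_cast h.trans hle
    exact (min_le_right _ _).trans (by linarith)
end

section
/- For n ≥ 2k, if A and B are disjoint cross-intersecting families of k-subsets of [n], then min{|A|, |B|} ≤ (1/2)·C(n-1, k-1)·(n-2)/(n-k-1). -/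
open Finset

/-- A real symmetric kernel on a finite set whose eigenvalues are all nonnegative
defines a nonnegative quadratic form. -/
theorem quadraticForm_nonneg_of_eigenvalues_nonneg {ι : Type*} [DecidableEq ι] (s : Finset ι)
    (m : ι → ι → ℝ) (hm : ∀ i j, m i j = m j i)
    (heig : ∀ (f : ι → ℝ) (μ : ℝ), (∃ i ∈ s, f i ≠ 0) →
      (∀ i ∈ s, ∑ j ∈ s, m i j * f j = μ * f i) → 0 ≤ μ) (f : ι → ℝ) :
    0 ≤ ∑ i ∈ s, ∑ j ∈ s, f i * (m i j * f j) := by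
  let M : Matrix s s ℝ := Matrix.of fun i j => m i j
  have hM : M.IsHermitian := by
    ext i j
    simp [M, hm]
  have hpos : M.PosSemidef := by
    rw [hM.posSemidef_iff_eigenvalues_nonneg]
    intro i
    let v : s → ℝ := hM.eigenvectorBasis i
    have hv0 : v ≠ 0 := by
      intro h
      exact hM.eigenvectorBasis.toBasis.ne_zero i (by
        ext j
        simpa using congrFun h j)
    have hv : M.mulVec v = hM.eigenvalues i • v := hM.mulVec_eigenvectorBasis i
    refine heig (fun j => if h : j ∈ s then v ⟨j, h⟩ else 0) _ ?_ ?_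
    · obtain ⟨j, hj⟩ := Function.ne_iff.1 hv0
      exact ⟨j, j.2, by simpa using hj⟩
    · intro j hj
      have := congrFun hv ⟨j, hj⟩
      rw [← Finset.sum_coe_sort]
      simpa [Matrix.mulVec, dotProduct, M, hj] using this
  have := hpos.dotProduct_mulVec_nonneg (fun i : s => f i)
  simp only [Matrix.mulVec, dotProduct, M, Matrix.of_apply, Pi.star_apply, star_trivial,
    Finset.mul_sum] at this
  rw [← Finset.sum_coe_sort s]
  simp_rw [← Finset.sum_coe_sort s (fun j => _ * (_ * _))]
  exact this

section

variable {α : Type*} [DecidableEq α]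

theorem card_filter_superset_powersetCard {X R : Finset α} (hXR : X ⊆ R) {k : ℕ}
    (hk : X.card ≤ k) :
    (#{T ∈ R.powersetCard k | X ⊆ T}) = (#R - #X).choose (k - #X) := by
  rw [← card_sdiff_of_subset hXR, ← card_powersetCard]
  refine card_bij' (fun T _ => T \ X) (fun T _ => T ∪ X) ?_ ?_ ?_ ?_
  · intro T hT
    simp only [mem_filter, mem_powersetCard] at hT ⊢
    exact ⟨sdiff_subset_sdiff hT.1.1 le_rfl, by rw [card_sdiff_of_subset hT.2, hT.1.2]⟩
  · intro T hT
    simp only [mem_filter, mem_powersetCard] at hT ⊢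
    have hd : Disjoint T X := disjoint_of_subset_left hT.1 sdiff_disjoint
    refine ⟨⟨union_subset (hT.1.trans sdiff_subset) hXR, ?_⟩, subset_union_right⟩
    rw [card_union_of_disjoint hd, hT.2]
    omega
  · intro T hT
    simp only [mem_filter] at hT
    exact sdiff_union_of_subset hT.2
  · intro T hT
    simp only [mem_powersetCard] at hT
    exact union_sdiff_cancel_right (disjoint_of_subset_left hT.1 sdiff_disjoint)

theorem sum_powersetCard_sum_powersetCard {i k : ℕ} (hik : i ≤ k) (h : Finset α → ℝ)
    (R : Finset α) :
    ∑ T ∈ R.powersetCard k, ∑ X ∈ T.powersetCard i, h X =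
      (#R - i).choose (k - i) * ∑ X ∈ R.powersetCard i, h X := by
  rw [mul_sum, sum_comm' (t' := R.powersetCard i)
    (s' := fun X => (R.powersetCard k).filter (X ⊆ ·))]
  · refine sum_congr rfl fun X hX => ?_
    rw [mem_powersetCard] at hX
    rw [sum_const, card_filter_superset_powersetCard hX.1 (hX.2.trans_le hik), hX.2,
      nsmul_eq_mul]
  · intro T X
    simp only [mem_powersetCard, mem_filter]
    constructor
    · rintro ⟨h1, h2⟩
      exact ⟨⟨h1, h2.1⟩, h2.1.trans h1.1, h2.2⟩
    · rintro ⟨h1, h2⟩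
      exact ⟨h1.1, h1.2, h2.2⟩

variable [Fintype α]

theorem sum_disjoint_eq_neg_one_pow_mul {i : ℕ} {h : Finset α → ℝ}
    (hh : ∀ Y : Finset α, #Y < i → ∑ X ∈ (univ.powersetCard i) with Y ⊆ X, h X = 0)
    (S : Finset α) :
    ∑ X ∈ (univ.powersetCard i) with Disjoint S X, h X =
      (-1) ^ i * ∑ X ∈ S.powersetCard i, h X := by
  have key : ∀ X : Finset α, (if Disjoint S X then h X else 0) =
      ∑ Z ∈ S.powerset, if Z ⊆ X then (-1 : ℝ) ^ #Z * h X else 0 := by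
    intro X
    have e : S.powerset.filter (· ⊆ X) = (S ∩ X).powerset := by
      ext Z
      simp only [mem_filter, mem_powerset, subset_inter_iff]
    rw [← sum_filter, e, ← sum_mul]
    have := congrArg (Int.cast : ℤ → ℝ) (sum_powerset_neg_one_pow_card (x := S ∩ X))
    push_cast at this
    rw [this]
    simp [disjoint_iff_inter_eq_empty]
  rw [sum_filter, sum_congr rfl fun X _ => key X, sum_comm, mul_sum,
    ← sum_filter_add_sum_filter_not S.powerset (fun Z => #Z = i), ← powersetCard_eq_filter]
  rw [sum_eq_zero (s := filter _ _), add_zero]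
  · refine sum_congr rfl fun Z hZ => ?_
    rw [mem_powersetCard] at hZ
    rw [sum_eq_single Z]
    · simp [hZ.2]
    · intro X hX hne
      rw [if_neg]
      intro hs
      exact hne (eq_of_subset_of_card_le hs (by rw [hZ.2, (mem_powersetCard.1 hX).2])).symm
    · intro hn
      exact absurd (mem_powersetCard.2 ⟨subset_univ _, hZ.2⟩) hn
  · intro Z hZ
    simp only [mem_filter] at hZ
    rw [← sum_filter, ← mul_sum]
    rcases lt_or_gt_of_ne hZ.2 with hlt | hgt
    · rw [hh Z hlt, mul_zero]
    · rw [filter_false_of_mem, sum_empty, mul_zero]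
      intro X hX hs
      have := card_le_card hs
      rw [(mem_powersetCard.1 hX).2] at this
      omega

theorem filter_disjoint_powersetCard_univ (S : Finset α) (k : ℕ) :
    (univ.powersetCard k).filter (Disjoint S ·) = Sᶜ.powersetCard k := by
  ext T
  simp [mem_powersetCard, subset_compl_iff_disjoint_left, and_comm]

/-- Upward lifts of harmonic functions are eigenvectors of the Kneser graph. -/
theorem kneser_lift_eigenvector {i k : ℕ} (hik : i ≤ k) {h : Finset α → ℝ}
    (hh : ∀ Y : Finset α, #Y < i → ∑ X ∈ (univ.powersetCard i) with Y ⊆ X, h X = 0)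
    {S : Finset α} (hS : #S = k) :
    ∑ T ∈ (univ.powersetCard k) with Disjoint S T, ∑ X ∈ T.powersetCard i, h X =
      (-1) ^ i * (Fintype.card α - k - i).choose (k - i) * ∑ X ∈ S.powersetCard i, h X := by
  rw [filter_disjoint_powersetCard_univ, sum_powersetCard_sum_powersetCard hik,
    ← filter_disjoint_powersetCard_univ, sum_disjoint_eq_neg_one_pow_mul hh, card_compl, hS]
  ring

theorem sum_superset_sum_superset {i k : ℕ} (f : Finset α → ℝ) {Y : Finset α}
    (hY : #Y ≤ i) :
    ∑ X ∈ (univ.powersetCard i) with Y ⊆ X, ∑ S ∈ (univ.powersetCard k) with X ⊆ S, f S =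
      (k - #Y).choose (i - #Y) * ∑ S ∈ (univ.powersetCard k) with Y ⊆ S, f S := by
  rw [mul_sum, sum_comm' (t' := (univ.powersetCard k).filter (Y ⊆ ·))
    (s' := fun S => (S.powersetCard i).filter (Y ⊆ ·))]
  · refine sum_congr rfl fun S hS => ?_
    simp only [mem_filter, mem_powersetCard] at hS
    rw [sum_const, card_filter_superset_powersetCard hS.2 hY, hS.1.2, nsmul_eq_mul]
  · intro X S
    simp only [mem_powersetCard, mem_filter]
    constructor
    · rintro ⟨⟨h1, h2⟩, h3, h4⟩
      exact ⟨⟨⟨h4, h1.2⟩, h2⟩, h3, h2.trans h4⟩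
    · rintro ⟨⟨⟨h1, h2⟩, h3⟩, h4, -⟩
      exact ⟨⟨⟨subset_univ _, h2⟩, h3⟩, h4, h1⟩

theorem sum_mul_sum_powersetCard (i k : ℕ) (f h : Finset α → ℝ) :
    ∑ S ∈ univ.powersetCard k, f S * ∑ X ∈ S.powersetCard i, h X =
      ∑ X ∈ univ.powersetCard i, h X * ∑ S ∈ (univ.powersetCard k) with X ⊆ S, f S := by
  simp_rw [mul_sum]
  rw [sum_comm' (t' := univ.powersetCard i)
    (s' := fun X => (univ.powersetCard k).filter (X ⊆ ·))]
  · exact sum_congr rfl fun X _ => sum_congr rfl fun S _ => mul_comm _ _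
  · intro S X
    simp only [mem_powersetCard, mem_filter]
    constructor
    · rintro ⟨h1, h2⟩
      exact ⟨⟨h1, h2.1⟩, subset_univ _, h2.2⟩
    · rintro ⟨h1, h2⟩
      exact ⟨h1.1, h1.2, h2.2⟩

/-- A linear combination `a K + b I + c J` of the Kneser adjacency matrix, the identity and the
all-ones matrix is positive semidefinite if its value on each eigenspace is nonnegative. -/
theorem kneser_quadraticForm_nonneg {k : ℕ} (a b c : ℝ)
    (h0 : 0 ≤ a * (Fintype.card α - k).choose k + b + c * (Fintype.card α).choose k)
    (hpos : ∀ i, 1 ≤ i → i ≤ k →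
      0 ≤ a * ((-1) ^ i * (Fintype.card α - k - i).choose (k - i)) + b)
    (f : Finset α → ℝ) :
    0 ≤ ∑ S ∈ (univ : Finset α).powersetCard k, ∑ T ∈ (univ : Finset α).powersetCard k,
      f S * ((a * (if Disjoint S T then 1 else 0) + b * (if S = T then 1 else 0) + c) * f T) := by
  refine quadraticForm_nonneg_of_eigenvalues_nonneg (univ.powersetCard k)
    (fun S T => a * (if Disjoint S T then 1 else 0) + b * (if S = T then 1 else 0) + c)
    (fun S T => by simp only [disjoint_comm, eq_comm]) ?_ f
  clear f
  rintro f μ ⟨S₀, hS₀, hf⟩ heig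
  set m : Finset α → Finset α → ℝ :=
    fun S T => a * (if Disjoint S T then 1 else 0) + b * (if S = T then 1 else 0) + c with hm
  have hmul : ∀ (g : Finset α → ℝ), ∀ S ∈ (univ : Finset α).powersetCard k,
      ∑ T ∈ univ.powersetCard k, m S T * g T =
        a * ∑ T ∈ (univ.powersetCard k) with Disjoint S T, g T + b * g S +
          c * ∑ T ∈ univ.powersetCard k, g T := by
    intro g S hS
    simp only [hm, add_mul, sum_add_distrib, mul_assoc, ← mul_sum, ite_mul, one_mul, zero_mul,
      sum_filter, sum_ite_eq, if_pos hS]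
  let F : Finset α → ℝ := fun Z => ∑ S ∈ (univ.powersetCard k) with Z ⊆ S, f S
  have hex : ∃ i, ∃ Z : Finset α, #Z = i ∧ F Z ≠ 0 := by
    refine ⟨k, S₀, (mem_powersetCard.1 hS₀).2, ?_⟩
    have : ((univ : Finset α).powersetCard k).filter (S₀ ⊆ ·) = {S₀} := by
      ext T
      simp only [mem_filter, mem_singleton]
      constructor
      · rintro ⟨h1, h2⟩
        refine (eq_of_subset_of_card_le h2 ?_).symm
        rw [(mem_powersetCard.1 h1).2, (mem_powersetCard.1 hS₀).2]
      · rintro rfl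
        exact ⟨hS₀, le_rfl⟩
    simpa only [F, this, sum_singleton] using hf
  classical
  obtain ⟨i, ⟨Z, hZi, hZ⟩, hmin⟩ : ∃ i, (∃ Z : Finset α, #Z = i ∧ F Z ≠ 0) ∧
      ∀ Y : Finset α, #Y < i → F Y = 0 :=
    ⟨Nat.find hex, Nat.find_spec hex, fun Y hY => by
      by_contra h
      exact Nat.find_min hex hY ⟨Y, rfl, h⟩⟩
  have hik : i ≤ k := by
    by_contra hlt
    refine hZ (sum_eq_zero fun S hS => ?_)
    simp only [mem_filter, mem_powersetCard] at hS
    have := card_le_card hS.2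
    omega
  have hharm : ∀ Y : Finset α, #Y < i →
      ∑ X ∈ (univ.powersetCard i) with Y ⊆ X, F X = 0 := fun Y hY => by
    rw [sum_superset_sum_superset f hY.le,
      show ∑ S ∈ (univ.powersetCard k) with Y ⊆ S, f S = 0 from hmin Y hY, mul_zero]
  let u : Finset α → ℝ := fun S => ∑ X ∈ S.powersetCard i, F X
  obtain ⟨ν, hν, hu⟩ : ∃ ν : ℝ, 0 ≤ ν ∧ ∀ S ∈ (univ : Finset α).powersetCard k,
      ∑ T ∈ univ.powersetCard k, m S T * u T = ν * u S := by
    rcases Nat.eq_zero_or_pos i with rfl | hi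
    · refine ⟨_, h0, fun S hS => ?_⟩
      rw [hmul u S hS, filter_disjoint_powersetCard_univ]
      simp only [u, powersetCard_zero, sum_singleton, sum_const, card_powersetCard, card_compl,
        nsmul_eq_mul, (mem_powersetCard.1 hS).2, card_univ]
      ring
    · refine ⟨_, hpos i hi hik, fun S hS => ?_⟩
      have hJ : ∑ T ∈ univ.powersetCard k, u T = 0 := by
        have := hharm ∅ (by simpa using hi)
        simp only [empty_subset, filter_true] at this
        rw [sum_powersetCard_sum_powersetCard hik, this, mul_zero]
      rw [hmul u S hS, hJ, kneser_lift_eigenvector hik hharm (mem_powersetCard.1 hS).2]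
      ring
  have hinner : 0 < ∑ S ∈ univ.powersetCard k, f S * u S := by
    rw [sum_mul_sum_powersetCard]
    exact sum_pos' (fun X _ => mul_self_nonneg (F X))
      ⟨Z, mem_powersetCard.2 ⟨subset_univ _, hZi⟩, mul_self_pos.2 hZ⟩
  have hsymm : μ * ∑ S ∈ univ.powersetCard k, f S * u S =
      ν * ∑ S ∈ univ.powersetCard k, f S * u S := by
    calc μ * ∑ S ∈ univ.powersetCard k, f S * u S
        = ∑ S ∈ univ.powersetCard k, ∑ T ∈ univ.powersetCard k, m S T * f T * u S := by
          rw [mul_sum]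
          refine sum_congr rfl fun S hS => ?_
          rw [← sum_mul, heig S hS, mul_assoc]
      _ = ∑ T ∈ univ.powersetCard k, ∑ S ∈ univ.powersetCard k, m S T * f T * u S := sum_comm
      _ = ν * ∑ S ∈ univ.powersetCard k, f S * u S := by
          rw [mul_sum]
          refine sum_congr rfl fun T hT => ?_
          rw [mul_left_comm, ← hu T hT, mul_sum]
          refine sum_congr rfl fun S _ => ?_
          simp only [hm, disjoint_comm, eq_comm (a := S)]
          ring
  rw [mul_right_cancel₀ hinner.ne' hsymm]
  exact hν

/-- The spectral bound for disjoint cross-intersecting families of equal size. -/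
theorem card_mul_le_of_disjoint_crossIntersecting {k : ℕ}
    (hn : 2 * k ≤ Fintype.card α) {A B : Finset (Finset α)}
    (hA : A ⊆ univ.powersetCard k) (hB : B ⊆ univ.powersetCard k) (hdisj : Disjoint A B)
    (hcross : ∀ a ∈ A, ∀ b ∈ B, ¬ Disjoint a b) (hcard : #A = #B) :
    2 * (#A : ℝ) * ((Fintype.card α - k).choose k + (Fintype.card α - k - 1).choose (k - 1)) ≤
      (Fintype.card α).choose k * ((Fintype.card α - k - 1).choose (k - 1) +
        (Fintype.card α - k - 2).choose (k - 2)) := by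
  set n := Fintype.card α
  set N : ℝ := ((n.choose k : ℕ) : ℝ)
  set d : ℝ := (((n - k).choose k : ℕ) : ℝ)
  set l₁ : ℝ := (((n - k - 1).choose (k - 1) : ℕ) : ℝ)
  set l₂ : ℝ := (((n - k - 2).choose (k - 2) : ℕ) : ℝ)
  have hN : 0 < N := Nat.cast_pos.2 (Nat.choose_pos (by omega))
  have hanti : ∀ i j, i ≤ j → j ≤ k →
      ((n - k - j).choose (k - j) : ℝ) ≤ (n - k - i).choose (k - i) := by
    intro i j hij hjk
    rw [← Nat.choose_symm (show k - j ≤ n - k - j by omega),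
      ← Nat.choose_symm (show k - i ≤ n - k - i by omega),
      show n - k - j - (k - j) = n - k - i - (k - i) by omega]
    exact_mod_cast Nat.choose_le_choose _ (by omega)
  let x : Finset α → ℝ := fun S => if S ∈ A then 1 else 0
  let y : Finset α → ℝ := fun S => if S ∈ B then 1 else 0
  have hlow := kneser_quadraticForm_nonneg (α := α) (k := k) 1 l₁ (-(d + l₁) / N)
    (by change 0 ≤ 1 * d + l₁ + -(d + l₁) / N * N
        rw [div_mul_cancel₀ _ hN.ne']
        linarith)
    (fun i hi hik => by
      have h1 : ((n - k - i).choose (k - i) : ℝ) ≤ l₁ := hanti 1 i hi hik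
      have h2 : (0 : ℝ) ≤ (n - k - i).choose (k - i) := by positivity
      rcases neg_one_pow_eq_or ℝ i with h | h <;> rw [h] <;> linarith)
    (fun S => x S + y S)
  have hupp := kneser_quadraticForm_nonneg (α := α) (k := k) (-1) l₂ (-(l₂ - d) / N)
    (by change 0 ≤ -1 * d + l₂ + -(l₂ - d) / N * N
        rw [div_mul_cancel₀ _ hN.ne']
        linarith)
    (fun i hi hik => by
      change 0 ≤ -1 * ((-1) ^ i * ((n - k - i).choose (k - i) : ℝ)) + l₂
      have h2 : (0 : ℝ) ≤ (n - k - i).choose (k - i) := by positivity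
      have h3 : (0 : ℝ) ≤ l₂ := by positivity
      rcases Nat.even_or_odd i with h | h
      · have h1 : ((n - k - i).choose (k - i) : ℝ) ≤ l₂ :=
          hanti 2 i (by obtain ⟨r, rfl⟩ := h; omega) hik
        rw [h.neg_one_pow]
        linarith
      · rw [h.neg_one_pow]
        linarith)
    (fun S => x S - y S)
  have hexp : ∀ (a b c : ℝ) (g : Finset α → ℝ),
      ∑ S ∈ (univ : Finset α).powersetCard k, ∑ T ∈ (univ : Finset α).powersetCard k,
        g S * ((a * (if Disjoint S T then 1 else 0) + b * (if S = T then 1 else 0) + c) * g T) =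
      a * (∑ S ∈ (univ : Finset α).powersetCard k, ∑ T ∈ (univ : Finset α).powersetCard k,
        (if Disjoint S T then g S * g T else 0)) +
      b * ∑ S ∈ (univ : Finset α).powersetCard k, g S * g S +
      c * (∑ S ∈ (univ : Finset α).powersetCard k, g S) ^ 2 := by
    intro a b c g
    rw [sq, sum_mul_sum]
    simp only [mul_sum, ← sum_add_distrib]
    refine sum_congr rfl fun S hS => ?_
    have : b * (g S * g S) = ∑ T ∈ (univ : Finset α).powersetCard k,
        if S = T then b * (g S * g T) else 0 := by
      rw [sum_ite_eq, if_pos hS]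
    rw [this, ← sum_add_distrib, ← sum_add_distrib]
    refine sum_congr rfl fun T _ => ?_
    split_ifs <;> ring
  rw [hexp] at hlow hupp
  have hxy : ∀ S, x S * y S = 0 := by
    intro S
    by_cases h : S ∈ A
    · simp [y, disjoint_left.1 hdisj h]
    · simp [x, h]
  have hsx : ∑ S ∈ (univ : Finset α).powersetCard k, x S = #A := by
    rw [sum_ite_mem, inter_eq_right.2 hA]
    simp
  have hsy : ∑ S ∈ (univ : Finset α).powersetCard k, y S = #A := by
    rw [sum_ite_mem, inter_eq_right.2 hB, hcard]
    simp
  have hxx : ∀ S, x S * x S = x S := fun S => by simp [x]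
  have hyy : ∀ S, y S * y S = y S := fun S => by simp [y]
  have hsq_add : ∑ S ∈ (univ : Finset α).powersetCard k, (x S + y S) * (x S + y S) = 2 * #A := by
    rw [two_mul]
    nth_rewrite 1 [← hsx]
    rw [← hsy, ← sum_add_distrib]
    exact sum_congr rfl fun S _ => by linear_combination hxx S + hyy S + 2 * hxy S
  have hsq_sub : ∑ S ∈ (univ : Finset α).powersetCard k, (x S - y S) * (x S - y S) = 2 * #A := by
    rw [two_mul]
    nth_rewrite 1 [← hsx]
    rw [← hsy, ← sum_add_distrib]
    exact sum_congr rfl fun S _ => by linear_combination hxx S + hyy S - 2 * hxy S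
  have hedges : ∑ S ∈ (univ : Finset α).powersetCard k, ∑ T ∈ (univ : Finset α).powersetCard k,
        (if Disjoint S T then (x S + y S) * (x T + y T) else 0) =
      ∑ S ∈ (univ : Finset α).powersetCard k, ∑ T ∈ (univ : Finset α).powersetCard k,
        (if Disjoint S T then (x S - y S) * (x T - y T) else 0) := by
    refine sum_congr rfl fun S _ => sum_congr rfl fun T _ => ?_
    split_ifs with h
    · have h1 : x S * y T = 0 := by
        by_cases hS : S ∈ A
        · have hT : T ∉ B := fun hT => hcross S hS T hT h
          simp [y, hT]
        · simp [x, hS]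
      have h2 : y S * x T = 0 := by
        by_cases hT : T ∈ A
        · have hS : S ∉ B := fun hS => hcross T hT S hS h.symm
          simp [y, hS]
        · simp [x, hT]
      linear_combination 2 * h1 + 2 * h2
    · rfl
  rw [hsq_add, sum_add_distrib, hsx, hsy, hedges] at hlow
  rw [hsq_sub, sum_sub_distrib, hsx, hsy] at hupp
  rcases Nat.eq_zero_or_pos (#A) with h0 | h0
  · rw [h0]
    simp only [Nat.cast_zero, mul_zero, zero_mul]
    positivity
  · have hA0 : (0 : ℝ) < #A := by exact_mod_cast h0
    have hsum : 0 ≤ (l₁ + l₂) * (2 * #A) + -(d + l₁) / N * (#A + #A : ℝ) ^ 2 := by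
      linarith
    have hfac : (l₁ + l₂) * (2 * #A) + -(d + l₁) / N * (#A + #A : ℝ) ^ 2 =
        (2 * #A / N) * (N * (l₁ + l₂) - 2 * #A * (d + l₁)) := by
      field_simp
      ring
    rw [hfac] at hsum
    have := nonneg_of_mul_nonneg_right hsum (by positivity)
    linarith

end

theorem stmt_11 (n k : ℕ) (hn : n ≥ 2 * k)
    (A B : Finset (Finset (Fin n)))
    (hA : A ⊆ Finset.powersetCard k Finset.univ)
    (hB : B ⊆ Finset.powersetCard k Finset.univ)
    (hdisj : Disjoint A B)
    (hcross : ∀ a ∈ A, ∀ b ∈ B, (a ∩ b).Nonempty) :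
    (min A.card B.card : ℚ) ≤
      (1 / 2) * (n - 1).choose (k - 1) * ((n - 2 : ℕ) : ℚ) / ((n - k - 1 : ℕ) : ℚ) := by
  rw [← Nat.cast_min]
  rcases Nat.lt_or_ge k 2 with hk | hk
  · have hzero : min (#A) (#B) = 0 := by
      by_contra hne
      obtain ⟨a, ha⟩ := card_pos.1 (show 0 < #A by omega)
      obtain ⟨b, hb⟩ := card_pos.1 (show 0 < #B by omega)
      have hca := (mem_powersetCard.1 (hA ha)).2
      have hcb := (mem_powersetCard.1 (hB hb)).2
      have hab := (hcross a ha b hb).card_pos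
      have h1 : a ∩ b = a := eq_of_subset_of_card_le inter_subset_left (by omega)
      have h2 : a ∩ b = b := eq_of_subset_of_card_le inter_subset_right (by omega)
      exact disjoint_left.1 hdisj ha (h1.symm.trans h2 ▸ hb)
    rw [hzero]
    positivity
  · obtain ⟨A', hAA', hA'⟩ := exists_subset_card_eq (min_le_left (#A) (#B))
    obtain ⟨B', hBB', hB'⟩ := exists_subset_card_eq (min_le_right (#A) (#B))
    have key := card_mul_le_of_disjoint_crossIntersecting (α := Fin n) (by simpa using hn)
      (hAA'.trans hA) (hBB'.trans hB) (disjoint_of_subset_left hAA'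
        (disjoint_of_subset_right hBB' hdisj))
      (fun a ha b hb => by
        rw [not_disjoint_iff_nonempty_inter]
        exact hcross a (hAA' ha) b (hBB' hb)) (hA'.trans hB'.symm)
    rw [hA', Fintype.card_fin] at key
    generalize min (#A) (#B) = m at key ⊢
    obtain ⟨k, rfl⟩ := Nat.exists_eq_add_of_le' hk
    obtain ⟨r, rfl⟩ := Nat.exists_eq_add_of_le' (show k + 4 ≤ n by omega)
    have hr : k ≤ r := by omega
    simp only [show r + (k + 4) - (k + 2) = r + 2 by omega, show r + 2 - 1 = r + 1 by omega,
      show r + 2 - 2 = r by omega, show k + 2 - 1 = k + 1 by omega,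
      show k + 2 - 2 = k by omega, show r + (k + 4) - 1 = r + k + 3 by omega,
      show r + (k + 4) - 2 = r + k + 2 by omega] at key ⊢
    have e1 := Nat.add_one_mul_choose_eq (r + 1) (k + 1)
    have e2 := Nat.add_one_mul_choose_eq r k
    have e3 := Nat.add_one_mul_choose_eq (r + k + 3) (k + 1)
    have hl : 0 < (r + 1).choose (k + 1) := Nat.choose_pos (by omega)
    have key' : 2 * (m : ℚ) * ((r + 2).choose (k + 2) + (r + 1).choose (k + 1)) ≤
        (r + (k + 4)).choose (k + 2) * ((r + 1).choose (k + 1) + r.choose k) := by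
      exact_mod_cast key
    rw [show r + (k + 4) = r + k + 3 + 1 by ring] at key'
    generalize (r + k + 3 + 1).choose (k + 1 + 1) = N at *
    generalize (r + k + 3).choose (k + 1) = M at *
    generalize (r + 1 + 1).choose (k + 1 + 1) = d at *
    generalize (r + 1).choose (k + 1) = l₁ at *
    generalize r.choose k = l₂ at *
    qify at e1 e2 e3 hl
    push_cast
    rw [le_div_iff₀ (by positivity)]
    have hd : (d : ℚ) = (r + 2) * l₁ / (k + 2) := by
      field_simp
      linarith
    have hl₂ : (l₂ : ℚ) = l₁ * (k + 1) / (r + 1) := by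
      field_simp
      linarith
    have hN : (N : ℚ) = (r + k + 4) * M / (k + 2) := by
      field_simp
      linarith
    rw [hd, hl₂, hN] at key'
    have hfac : (r + k + 4 : ℚ) * M / (k + 2) * (l₁ + l₁ * (k + 1) / (r + 1)) -
        2 * m * ((r + 2) * l₁ / (k + 2) + l₁) =
        (2 * l₁ * (r + k + 4) / ((k + 2) * (r + 1))) *
          (1 / 2 * M * (r + k + 2) - m * (r + 1)) := by
      field_simp
      ring
    have hprod := sub_nonneg.2 key'
    rw [hfac] at hprod
    have := nonneg_of_mul_nonneg_right hprod (by positivity)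
    linarith
end
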